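/- Let 0 < r < 1/3 and let n = 2m+1 be odd. Then the caustic of R_r^n is singular at φ = 0 and φ = π: one has x_n'(0) = y_n'(0) = 0 and x_n'(π) = y_n'(π) = 0. -/

import Mathlib

open Real Filter

/-- The reflection map of the unit circle with light source at `(r,0)`. -/
noncomputable def R (r : ℝ) (φ : ℝ) : ℝ :=
  φ + π - 2 * arctan (r * sin φ / (1 - r * cos φ))

/-- The angle `φ_c ∈ (0,π)` with `cos φ_c = (1 − √(1+8r²))/(4r)`. -/
noncomputable def φc (r : ℝ) : ℝ :=
  arccos ((1 - Real.sqrt (1 + 8 * r ^ 2)) / (4 * r))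

/-- `x`-coordinate of the caustic of `R_r^n`. -/
noncomputable def xc (r : ℝ) (n : ℕ) (φ : ℝ) : ℝ :=
  (deriv ((R r)^[n]) φ * cos φ + cos ((R r)^[n] φ)) / (1 + deriv ((R r)^[n]) φ)

/-- `y`-coordinate of the caustic of `R_r^n`. -/
noncomputable def yc (r : ℝ) (n : ℕ) (φ : ℝ) : ℝ :=
  (deriv ((R r)^[n]) φ * sin φ + sin ((R r)^[n] φ)) / (1 + deriv ((R r)^[n]) φ)

/-- The quantity `A_n(φ) = −(R_r^n)'(φ) + ((R_r^n)'(φ))³ + 2 (R_r^n)'''(φ)`. -/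
noncomputable def A (r : ℝ) (n : ℕ) (φ : ℝ) : ℝ :=
  -(deriv ((R r)^[n]) φ) + (deriv ((R r)^[n]) φ) ^ 3 + 2 * iteratedDeriv 3 ((R r)^[n]) φ

lemma one_sub_mul_cos_pos {r : ℝ} (hr : 0 < r) (hr1 : r < 1) (φ : ℝ) : 0 < 1 - r * cos φ := by
  nlinarith [cos_le_one φ]

lemma contDiff_R {r : ℝ} (hr : 0 < r) (hr1 : r < 1) : ContDiff ℝ 2 (R r) := by
  unfold R
  have h (φ : ℝ) : 1 - r * cos φ ≠ 0 := (one_sub_mul_cos_pos hr hr1 φ).ne'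
  exact (contDiff_id.add contDiff_const).sub (contDiff_const.mul
    (((contDiff_const.mul contDiff_sin).div
      (contDiff_const.sub (contDiff_const.mul contDiff_cos)) h).arctan))

lemma contDiff_iterate_R {r : ℝ} (hr : 0 < r) (hr1 : r < 1) (n : ℕ) :
    ContDiff ℝ 2 (R r)^[n] := by
  induction n with
  | zero => exact contDiff_id
  | succ n ih => exact ih.comp (contDiff_R hr hr1)

lemma deriv_R_pos {r : ℝ} (hr : 0 < r) (hr1 : r < 1 / 3) (φ : ℝ) : 0 < deriv (R r) φ := by
  have hpos := one_sub_mul_cos_pos hr (by linarith) φ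
  have h : HasDerivAt (R r) (1 - 2 * (1 / (1 + (r * sin φ / (1 - r * cos φ)) ^ 2) *
      ((r * cos φ * (1 - r * cos φ) - r * sin φ * (-(r * -sin φ))) / (1 - r * cos φ) ^ 2))) φ :=
    ((hasDerivAt_id φ).add_const π).sub
      (((((hasDerivAt_sin φ).const_mul r).div
        (((hasDerivAt_cos φ).const_mul r).const_sub 1) hpos.ne').arctan).const_mul 2)
  have hden : 0 < (1 - r * cos φ) ^ 2 + (r * sin φ) ^ 2 := by positivity
  have heq : 1 - 2 * (1 / (1 + (r * sin φ / (1 - r * cos φ)) ^ 2) *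
      ((r * cos φ * (1 - r * cos φ) - r * sin φ * (-(r * -sin φ))) / (1 - r * cos φ) ^ 2)) =
      (1 - 4 * r * cos φ + 3 * r ^ 2) / ((1 - r * cos φ) ^ 2 + (r * sin φ) ^ 2) := by
    have hne := hpos.ne'
    have hden' := hden.ne'
    field_simp
    linear_combination (3 * r ^ 2) * sin_sq_add_cos_sq φ
  rw [h.deriv, heq]
  refine div_pos ?_ hden
  nlinarith [mul_le_mul_of_nonneg_left (cos_le_one φ) hr.le]

lemma deriv_iterate_R_pos {r : ℝ} (hr : 0 < r) (hr1 : r < 1 / 3) (n : ℕ) (φ : ℝ) :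
    0 < deriv (R r)^[n] φ := by
  have hr' : r < 1 := by linarith
  induction n generalizing φ with
  | zero => simp
  | succ n ih =>
    rw [Function.iterate_succ, deriv_comp _
      ((contDiff_iterate_R hr hr' n).differentiable (by norm_num) _)
      ((contDiff_R hr hr').differentiable (by norm_num) _)]
    exact mul_pos (ih _) (deriv_R_pos hr hr1 φ)

lemma R_of_sin_eq_zero (r : ℝ) {p : ℝ} (hp : sin p = 0) : R r p = p + π := by
  simp [R, hp]

lemma cos_two_mul_sub_of_sin_eq_zero {p : ℝ} (hp : sin p = 0) (φ : ℝ) :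
    cos (2 * p - φ) = cos φ := by
  rw [cos_sub, cos_two_mul, sin_two_mul, cos_sq', hp]
  ring

lemma sin_two_mul_sub_of_sin_eq_zero {p : ℝ} (hp : sin p = 0) (φ : ℝ) :
    sin (2 * p - φ) = -sin φ := by
  rw [sin_sub, cos_two_mul, sin_two_mul, cos_sq', hp]
  ring

lemma R_two_mul_sub (r : ℝ) {p : ℝ} (hp : sin p = 0) (φ : ℝ) :
    R r (2 * p - φ) = 2 * R r p - R r φ := by
  rw [R_of_sin_eq_zero r hp, R, R, cos_two_mul_sub_of_sin_eq_zero hp,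
    sin_two_mul_sub_of_sin_eq_zero hp, mul_neg, neg_div, arctan_neg]
  ring

lemma iterate_R_of_sin_eq_zero (r : ℝ) (n : ℕ) {p : ℝ} (hp : sin p = 0) :
    (R r)^[n] p = p + n * π := by
  induction n with
  | zero => simp
  | succ n ih =>
    rw [Function.iterate_succ_apply', ih, R_of_sin_eq_zero r]
    · push_cast; ring
    · rw [sin_add_nat_mul_pi, hp, mul_zero]

lemma sin_iterate_R_of_sin_eq_zero (r : ℝ) (n : ℕ) {p : ℝ} (hp : sin p = 0) :
    sin ((R r)^[n] p) = 0 := by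
  rw [iterate_R_of_sin_eq_zero r n hp, sin_add_nat_mul_pi, hp, mul_zero]

lemma iterate_R_two_mul_sub (r : ℝ) (n : ℕ) {p : ℝ} (hp : sin p = 0) (φ : ℝ) :
    (R r)^[n] (2 * p - φ) = 2 * (R r)^[n] p - (R r)^[n] φ := by
  induction n with
  | zero => rfl
  | succ n ih =>
    simp only [Function.iterate_succ_apply', ih]
    exact R_two_mul_sub r (sin_iterate_R_of_sin_eq_zero r n hp) _

lemma deriv_iterate_R_two_mul_sub (r : ℝ) (n : ℕ) {p : ℝ} (hp : sin p = 0) (φ : ℝ) :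
    deriv (R r)^[n] (2 * p - φ) = deriv (R r)^[n] φ := by
  have h := congrArg (deriv · φ) (funext (iterate_R_two_mul_sub r n hp))
  simpa [deriv_comp_const_sub] using h

lemma deriv_eq_zero_of_two_mul_sub {f : ℝ → ℝ} {p : ℝ} (hf : ∀ φ, f (2 * p - φ) = f φ) :
    deriv f p = 0 := by
  have h := congrArg (deriv · p) (funext hf)
  simp only [deriv_comp_const_sub, two_mul, add_sub_cancel_right] at h
  linarith

lemma deriv_xc_eq_zero (r : ℝ) (n : ℕ) {p : ℝ} (hp : sin p = 0) : deriv (xc r n) p = 0 := by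
  refine deriv_eq_zero_of_two_mul_sub fun φ ↦ ?_
  rw [xc, xc, deriv_iterate_R_two_mul_sub r n hp, iterate_R_two_mul_sub r n hp,
    cos_two_mul_sub_of_sin_eq_zero hp,
    cos_two_mul_sub_of_sin_eq_zero (sin_iterate_R_of_sin_eq_zero r n hp)]

lemma deriv_yc_eq_zero {r : ℝ} (hr : 0 < r) (hr1 : r < 1 / 3) {n : ℕ} (hn : Odd n) {p : ℝ}
    (hp : sin p = 0) : deriv (yc r n) p = 0 := by
  have hsmooth := contDiff_iterate_R hr (by linarith) n
  have hF := (hsmooth.differentiable (by norm_num) p).hasDerivAt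
  have hF' := ((contDiff_succ_iff_deriv (n := 1)).1 hsmooth).2.2.differentiable
    (by norm_num) p |>.hasDerivAt
  have hsin := sin_iterate_R_of_sin_eq_zero r n hp
  have hcos : cos ((R r)^[n] p) = -cos p := by
    rw [iterate_R_of_sin_eq_zero r n hp, cos_add_nat_mul_pi, hn.neg_one_pow, neg_one_mul]
  have hy := ((hF'.mul (hasDerivAt_sin p)).add hF.sin).div (hF'.const_add 1)
    (add_pos one_pos (deriv_iterate_R_pos hr hr1 n p)).ne'
  refine (hy.congr_deriv ?_).deriv
  simp [hp, hsin, hcos, mul_comm]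

theorem stmt_15 (r : ℝ) (hr : 0 < r) (hr1 : r < 1 / 3) (m : ℕ) :
    deriv (xc r (2 * m + 1)) 0 = 0 ∧ deriv (yc r (2 * m + 1)) 0 = 0 ∧
    deriv (xc r (2 * m + 1)) π = 0 ∧ deriv (yc r (2 * m + 1)) π = 0 :=
  ⟨deriv_xc_eq_zero r _ sin_zero, deriv_yc_eq_zero hr hr1 (odd_two_mul_add_one m) sin_zero,
    deriv_xc_eq_zero r _ sin_pi, deriv_yc_eq_zero hr hr1 (odd_two_mul_add_one m) sin_pi⟩
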